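/- There exists a universal constant c > 0 such that the following holds. Let N ≥ 2, k ≥ 2, and let U ∈ ℝ^{N×N} be a good orthogonal matrix. Let D_{U,k} be the distribution on {-1,1}^{kN} defined from U, and for S ⊆ [kN] let D̂_{U,k}(S) = E_{z∼D_{U,k}}[∏_{i∈S} z_i]. Then for every nonempty S ⊆ [kN]: |D̂_{U,k}(S)| ≤ (c·|S|·ln N / N)^{|S|·(1-1/k)/2}; moreover, D̂_{U,k}(S) = 0 for every nonempty S with |S| < k. -/

import Mathlib

open scoped BigOperators
open MeasureTheory

/-- `U : Fin N → Fin N → ℝ` (viewed as an `N × N` real matrix `U i j`) is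
orthogonal: its columns and its rows are orthonormal. -/
def IsOrthogonal {N : ℕ} (U : Fin N → Fin N → ℝ) : Prop :=
  (∀ j₁ j₂ : Fin N, ∑ i, U i j₁ * U i j₂ = if j₁ = j₂ then (1 : ℝ) else 0) ∧
  (∀ i₁ i₂ : Fin N, ∑ j, U i₁ j * U i₂ j = if i₁ = i₂ then (1 : ℝ) else 0)

/-- The sign function into `{-1,1}`: `sgn t = 1` if `t ≥ 0`, and `-1` otherwise. -/
noncomputable def sgn (t : ℝ) : ℝ := if 0 ≤ t then 1 else -1

/-- The standard Gaussian measure on `ℝ^N`. -/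
noncomputable def stdGaussianVec (N : ℕ) : MeasureTheory.Measure (Fin N → ℝ) :=
  MeasureTheory.Measure.pi fun _ => ProbabilityTheory.gaussianReal 0 1

/-- The law of `m` independent standard Gaussian vectors in `ℝ^N`. -/
noncomputable def stdGaussianFam (N m : ℕ) :
    MeasureTheory.Measure (Fin m → Fin N → ℝ) :=
  MeasureTheory.Measure.pi fun _ => stdGaussianVec N

/-- Given independent standard Gaussian vectors `X^{(1)},…,X^{(k-1)}` in `ℝ^N`
(indexed here by `Fin (k-1)`), with `Y^{(i)} = Uᵀ X^{(i)}`, the vectors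
`Z^{(1)} = X^{(1)}`, `Z^{(i)} = Y^{(i-1)} ⊙ X^{(i)}` for `2 ≤ i ≤ k-1`, and
`Z^{(k)} = Y^{(k-1)}` (0-indexed below; out-of-range cases give junk `0`). -/
noncomputable def Zfam (N k : ℕ) (U : Fin N → Fin N → ℝ)
    (X : Fin (k - 1) → Fin N → ℝ) : Fin k → Fin N → ℝ := fun a j =>
  if a.val = 0 then
    (if h : 0 < k - 1 then X ⟨0, h⟩ j else 0)
  else if a.val = k - 1 then
    (if h : k - 2 < k - 1 then ∑ l, U l j * X ⟨k - 2, h⟩ l else 0)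
  else
    (if h : a.val - 1 < k - 1 ∧ a.val < k - 1 then
      (∑ l, U l j * X ⟨a.val - 1, h.1⟩ l) * X ⟨a.val, h.2⟩ j
    else 0)

/-- The operator (spectral) norm of a real matrix `A` (given as a function):
`‖A‖ = sup_{x ≠ 0} ‖Ax‖₂ / ‖x‖₂` (and `0` if the index types are empty). -/
noncomputable def opNorm {m n : Type} [Fintype m] [Fintype n]
    (A : m → n → ℝ) : ℝ :=
  sSup {r : ℝ | ∃ x : n → ℝ, x ≠ 0 ∧
    r = Real.sqrt (∑ i, (∑ j, A i j * x j) ^ 2) / Real.sqrt (∑ j, x j ^ 2)}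

/-- The operator norm of the submatrix `U_{S,T}` of `U` with rows indexed by
`S` and columns indexed by `T`. -/
noncomputable def subOpNorm {N : ℕ} (U : Fin N → Fin N → ℝ)
    (S T : Finset (Fin N)) : ℝ :=
  opNorm (fun (i : {a // a ∈ S}) (j : {a // a ∈ T}) => U i.val j.val)

/-- `Ũ(S,T) = E_X[ sgn( ∏_{i∈S} X_i · ∏_{j∈T} (UᵀX)_j ) ]` for a standard
Gaussian vector `X` in `ℝ^N`. -/
noncomputable def Utilde (N : ℕ) (U : Fin N → Fin N → ℝ)
    (S T : Finset (Fin N)) : ℝ :=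
  ∫ X, sgn ((∏ i ∈ S, X i) * ∏ j ∈ T, ∑ l, U l j * X l) ∂(stdGaussianVec N)

/-- An orthogonal matrix `U ∈ ℝ^{N×N}` is *good* if every nonempty submatrix
`U_{S,T}` satisfies `‖U_{S,T}‖ ≤ √(100·(|S|+|T|)·ln N / N)`. -/
def IsGood {N : ℕ} (U : Fin N → Fin N → ℝ) : Prop :=
  ∀ S T : Finset (Fin N), S.Nonempty → T.Nonempty →
    subOpNorm U S T ≤ Real.sqrt (100 * (S.card + T.card) * Real.log N / N)

/-- `D̂_{U,k}(S) = E_{z ∼ D_{U,k}}[∏_{(a,j) ∈ S} z_{a,j}]`, the `S`-moment of the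
distribution `D_{U,k}` of `(sgn(Z^{(1)}),…,sgn(Z^{(k)})) ∈ {-1,1}^{kN}`
(coordinates indexed by `Fin k × Fin N`). -/
noncomputable def Dhat (N k : ℕ) (U : Fin N → Fin N → ℝ)
    (S : Finset (Fin k × Fin N)) : ℝ :=
  ∫ X, ∏ p ∈ S, sgn (Zfam N k U X p.1 p.2) ∂(stdGaussianFam N (k - 1))

/-- The intersection of `S ⊆ [k] × [N]` with the `m`-th block (0-indexed). -/
def blockOf {N k : ℕ} (S : Finset (Fin k × Fin N)) (m : ℕ) : Finset (Fin N) :=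
  (S.filter fun p => p.1.val = m).image Prod.snd

noncomputable abbrev gam : Measure ℝ := ProbabilityTheory.gaussianReal 0 1

noncomputable abbrev gpi (ι : Type) [Fintype ι] : Measure (ι → ℝ) := Measure.pi fun _ => gam

/-- linear map of a matrix -/
def lm {κ ι : Type} [Fintype ι] (L : κ → ι → ℝ) (x : ι → ℝ) : κ → ℝ := fun i => ∑ l, L i l * x l

lemma continuous_lm {κ ι : Type} [Fintype ι] (L : κ → ι → ℝ) : Continuous (lm L) := by
  unfold lm; fun_prop

lemma measurable_lm {κ ι : Type} [Fintype ι] (L : κ → ι → ℝ) : Measurable (lm L) := by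
  unfold lm; fun_prop

lemma charFunDual_lm {κ ι : Type} [Fintype ι] [Fintype κ] [DecidableEq κ] (L : κ → ι → ℝ)
    (φ : StrongDual ℝ (κ → ℝ)) :
    charFunDual ((gpi ι).map (lm L)) φ =
      Complex.exp (-(((∑ i, ∑ j, φ (Pi.single i 1) * φ (Pi.single j 1) * ∑ l, L i l * L j l : ℝ) : ℂ)) / 2) := by
  have hφ : ∀ y : κ → ℝ, φ y = ∑ i, φ (Pi.single i 1) * y i := by
    intro y
    conv_lhs => rw [pi_eq_sum_univ' y]
    rw [map_sum]
    refine Finset.sum_congr rfl fun i _ => ?_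
    rw [map_smul, smul_eq_mul, mul_comm]
  rw [charFunDual_apply, integral_map (measurable_lm L).aemeasurable (by fun_prop)]
  set b : ι → ℝ := fun l => ∑ i, φ (Pi.single i 1) * L i l with hb
  have h1 : ∀ x : ι → ℝ, Complex.exp ((φ (lm L x) : ℂ) * Complex.I) =
      ∏ l, Complex.exp ((b l : ℂ) * (x l : ℂ) * Complex.I) := by
    intro x
    rw [← Complex.exp_sum, ← Finset.sum_mul, hφ]
    congr 2
    norm_cast
    simp only [lm, hb, Finset.mul_sum, Finset.sum_mul]
    rw [Finset.sum_comm]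
    simp only [mul_assoc]
  simp_rw [h1]
  rw [integral_fintype_prod_eq_prod (f := fun l (t : ℝ) => Complex.exp ((b l : ℂ) * (t : ℂ) * Complex.I))]
  simp_rw [← charFun_apply_real, ProbabilityTheory.charFun_gaussianReal]
  rw [← Complex.exp_sum]
  congr 1
  have : (∑ i, ∑ j, φ (Pi.single i 1) * φ (Pi.single j 1) * ∑ l, L i l * L j l : ℝ) = ∑ l, b l ^ 2 := by
    have h2 : ∀ l, b l ^ 2 = ∑ i, ∑ j, (φ (Pi.single i 1) * L i l) * (φ (Pi.single j 1) * L j l) := by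
      intro l
      rw [hb, sq, Finset.sum_mul_sum]
    simp only [h2, Finset.mul_sum]
    conv_rhs => rw [Finset.sum_comm]
    refine Finset.sum_congr rfl fun i _ => ?_
    conv_rhs => rw [Finset.sum_comm]
    refine Finset.sum_congr rfl fun j _ => Finset.sum_congr rfl fun l _ => ?_
    ring
  rw [this]
  push_cast
  rw [neg_div, Finset.sum_div, ← Finset.sum_neg_distrib]
  refine Finset.sum_congr rfl fun l _ => ?_
  simp

lemma map_lm_eq {κ ι ι' : Type} [Fintype ι] [Fintype ι'] [Fintype κ] (L : κ → ι → ℝ)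
    (L' : κ → ι' → ℝ) (h : ∀ i j, ∑ l, L i l * L j l = ∑ l, L' i l * L' j l) :
    (gpi ι).map (lm L) = (gpi ι').map (lm L') := by
  classical
  have := Measure.isProbabilityMeasure_map (μ := gpi ι) (measurable_lm L).aemeasurable
  have := Measure.isProbabilityMeasure_map (μ := gpi ι') (measurable_lm L').aemeasurable
  apply Measure.ext_of_charFunDual
  ext φ
  rw [charFunDual_lm, charFunDual_lm]
  simp_rw [h]

lemma map_lm_orth {κ ι : Type} [Fintype ι] [Fintype κ] [DecidableEq κ] (L : κ → ι → ℝ) 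
    (r : ℝ) (h : ∀ i j, ∑ l, L i l * L j l = if i = j then r ^ 2 else 0) :
    (gpi ι).map (lm L) = (gpi κ).map (fun x i => r * x i) := by
  have : (fun (x : κ → ℝ) i => r * x i) = lm (fun i j : κ => if i = j then r else 0) := by
    ext x i; simp [lm]
  rw [this]
  apply map_lm_eq
  intro i j
  rw [h]
  simp only [ite_mul, zero_mul, Finset.sum_ite_eq, Finset.mem_univ, if_true, mul_ite, mul_zero]
  by_cases hij : i = j
  · simp [hij, sq]
  · simp [hij]

lemma measurable_sgn : Measurable sgn :=
  Measurable.ite measurableSet_Ici measurable_const measurable_const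

lemma abs_sgn (t : ℝ) : |sgn t| = 1 := by unfold sgn; split_ifs <;> simp

lemma gam_Icc (r : ℝ) (hr : 0 ≤ r) : gam.real (Set.Icc (-r) r) ≤ r := by
  have h : gam (Set.Icc (-r) r) ≤ ENNReal.ofReal r := by
    rw [ProbabilityTheory.gaussianReal_apply _ (by simp)]
    calc ∫⁻ x in Set.Icc (-r) r, ProbabilityTheory.gaussianPDF 0 1 x
        ≤ ∫⁻ x in Set.Icc (-r) r, ENNReal.ofReal (1/2) := by
          apply lintegral_mono
          intro x
          apply ENNReal.ofReal_le_ofReal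
          unfold ProbabilityTheory.gaussianPDFReal
          have h2 : (2:ℝ) ≤ √(2 * Real.pi * ((1 : NNReal) : ℝ)) := by
            apply Real.le_sqrt_of_sq_le
            have := Real.pi_gt_three
            simp; linarith
          have h3 : (√(2 * Real.pi * ((1 : NNReal) : ℝ)))⁻¹ ≤ 1/2 := by
            rw [one_div]; exact inv_anti₀ (by norm_num) h2
          have h4 : Real.exp (-(x - 0) ^ 2 / (2 * ((1 : NNReal) : ℝ))) ≤ 1 := by
            apply Real.exp_le_one_iff.2
            have := sq_nonneg (x - 0)
            simp only [NNReal.coe_one]; linarith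
          calc _ ≤ (1/2 : ℝ) * 1 := by gcongr
            _ = _ := by norm_num
      _ = ENNReal.ofReal r := by
          rw [lintegral_const, Measure.restrict_apply_univ, Real.volume_Icc,
            ← ENNReal.ofReal_mul (by norm_num)]
          congr 1; ring
  exact ENNReal.toReal_le_of_le_ofReal hr h

lemma integrable_sgn_comp {Ω : Type*} [MeasurableSpace Ω] (μ : Measure Ω) [IsFiniteMeasure μ]
    (f : Ω → ℝ) (hf : Measurable f) : Integrable (fun x => sgn (f x)) μ :=
  Integrable.of_bound (measurable_sgn.comp hf).aestronglyMeasurable 1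
    (Filter.Eventually.of_forall fun x => by simp [abs_sgn])

/-- noise-smoothed sign -/
noncomputable def hh (a m : ℝ) : ℝ := ∫ z, sgn (m + a * z) ∂gam

lemma hh_bound (a m : ℝ) (ha : 0 < a) : |hh a m| ≤ |m| / a := by
  have hneg : hh a m = ∫ z, sgn (m - a * z) ∂gam := by
    unfold hh
    have h := ProbabilityTheory.gaussianReal_map_neg (μ := 0) (v := 1)
    rw [neg_zero] at h
    conv_lhs => rw [gam, ← h]
    have hm : Measurable fun z => sgn (m + a * z) := measurable_sgn.comp (by fun_prop)
    rw [integral_map (by fun_prop) hm.aestronglyMeasurable]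
    simp [sub_eq_add_neg]
  have h2 : hh a m = ∫ z, (sgn (m + a * z) + sgn (m - a * z)) / 2 ∂gam := by
    rw [integral_div, integral_add (integrable_sgn_comp _ _ (by fun_prop))
      (integrable_sgn_comp _ _ (by fun_prop)), ← hneg]
    unfold hh; ring
  rw [h2]
  have hr : 0 ≤ |m| / a := by positivity
  refine (abs_integral_le_integral_abs).trans ?_
  refine le_trans (integral_mono_of_nonneg (g := (Set.Icc (-(|m| / a)) (|m| / a)).indicator 1)
    (Filter.Eventually.of_forall fun _ => abs_nonneg _) ?_ ?_) ?_
  · exact (integrable_const (1:ℝ)).indicator measurableSet_Icc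
  · refine Filter.Eventually.of_forall fun z => ?_
    by_cases hz : z ∈ Set.Icc (-(|m| / a)) (|m| / a)
    · simp only [Set.indicator_of_mem hz, Pi.one_apply, abs_div]
      have := abs_add_le (sgn (m + a * z)) (sgn (m - a * z))
      rw [abs_sgn, abs_sgn] at this
      rw [abs_two]; linarith
    · simp only [Set.indicator_of_notMem hz]
      rw [Set.mem_Icc, ← abs_le, not_le, div_lt_iff₀ ha] at hz
      have hz' : |m| < |a * z| := by rw [abs_mul, abs_of_pos ha]; linarith
      have : sgn (m + a * z) + sgn (m - a * z) = 0 := by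
        unfold sgn
        rcases abs_cases m with ⟨h1, _⟩ | ⟨h1, _⟩ <;> rcases abs_cases (a*z) with ⟨h2, _⟩ | ⟨h2, _⟩ <;>
          rw [h1, h2] at hz' <;> split_ifs <;> linarith
      simp [this]
  · rw [integral_indicator_one measurableSet_Icc]
    exact gam_Icc _ hr

lemma measurable_hh (a : ℝ) : Measurable (hh a) := by
  unfold hh
  apply StronglyMeasurable.measurable
  apply StronglyMeasurable.integral_prod_right' (f := fun p : ℝ × ℝ => sgn (p.1 + a * p.2))
  exact (measurable_sgn.comp (by fun_prop)).stronglyMeasurable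

lemma integral_abs_gam : ∫ z, |z| ∂gam ≤ 1 := by
  have hs : Integrable (fun z : ℝ => z ^ 2) gam := 
    (ProbabilityTheory.memLp_id_gaussianReal (μ := 0) (v := 1) 2).integrable_sq
  have h1 : ∫ z, z ^ 2 ∂gam = 1 := by
    have := ProbabilityTheory.variance_id_gaussianReal (μ := 0) (v := 1)
    rw [ProbabilityTheory.variance_eq_integral (by fun_prop)] at this
    simpa using this
  calc ∫ z, |z| ∂gam ≤ ∫ z, (1 + z ^ 2) / 2 ∂gam := by
        refine integral_mono_of_nonneg (Filter.Eventually.of_forall fun _ => abs_nonneg _)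
          (((integrable_const 1).add hs).div_const 2) (Filter.Eventually.of_forall fun z => ?_)
        have := sq_nonneg (|z| - 1)
        have := sq_abs z
        simp only; nlinarith
    _ = 1 := by
        rw [integral_div, integral_add (integrable_const _) hs, h1]; simp

lemma integral_hh (a r : ℝ) (ha : 0 < a) (hr : 0 ≤ r) : ∫ z, |hh a (r * z)| ∂gam ≤ r / a := by
  have hi : Integrable (fun z : ℝ => |z|) gam := 
    ((ProbabilityTheory.memLp_id_gaussianReal (μ := 0) (v := 1) 1).integrable (by simp)).abs
  calc ∫ z, |hh a (r * z)| ∂gam ≤ ∫ z, (r / a) * |z| ∂gam := by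
        refine integral_mono_of_nonneg (Filter.Eventually.of_forall fun _ => abs_nonneg _)
          (hi.const_mul _) (Filter.Eventually.of_forall fun z => ?_)
        refine (hh_bound a _ ha).trans_eq ?_
        rw [abs_mul, abs_of_nonneg hr]; ring
    _ ≤ (r / a) * 1 := by
        rw [integral_const_mul]
        gcongr
        exact integral_abs_gam
    _ = _ := mul_one _

lemma measurable_prod_sgn {Ω : Type*} [MeasurableSpace Ω] {τ : Type} (s : Finset τ) (f : τ → Ω → ℝ)
    (hf : ∀ t, Measurable (f t)) : Measurable fun x => ∏ t ∈ s, sgn (f t x) :=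
  Finset.measurable_fun_prod _ fun t _ => measurable_sgn.comp (hf t)

lemma abs_prod_sgn {τ : Type} (s : Finset τ) (f : τ → ℝ) : |∏ t ∈ s, sgn (f t)| = 1 := by
  rw [Finset.abs_prod]; simp [abs_sgn]

lemma integrable_of_abs_le_one {Ω : Type*} [MeasurableSpace Ω] (μ : Measure Ω) [IsFiniteMeasure μ]
    (f : Ω → ℝ) (hf : Measurable f) (h : ∀ x, |f x| ≤ 1) : Integrable f μ :=
  Integrable.of_bound hf.aestronglyMeasurable 1 (Filter.Eventually.of_forall h)

/-- correlated matrix -/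
def Lmat {σ τ : Type} [DecidableEq σ] [DecidableEq τ] (K : τ → σ ⊕ τ → ℝ) (a : ℝ) :
    σ ⊕ τ → (σ ⊕ τ) ⊕ τ → ℝ
  | .inl s, .inl (.inl s') => if s = s' then 1 else 0
  | .inl _, .inl (.inr _) => 0
  | .inl _, .inr _ => 0
  | .inr t, .inl w => K t w
  | .inr t, .inr t' => if t = t' then a else 0

lemma smooth_bound {σ τ : Type} [Fintype σ] [Fintype τ] [DecidableEq σ] [DecidableEq τ]
    (K : τ → σ ⊕ τ → ℝ) (r a : ℝ) (hr : 0 ≤ r) (ha : 0 < a)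
    (hK : ∀ i j, ∑ l, K i l * K j l = if i = j then r ^ 2 else 0) :
    |∫ x, (∏ s, sgn (lm (Lmat K a) x (.inl s))) * ∏ t, sgn (lm (Lmat K a) x (.inr t))
      ∂(gpi ((σ ⊕ τ) ⊕ τ))| ≤ (r / a) ^ Fintype.card τ := by
  have hmp := measurePreserving_sumPiEquivProdPi_symm (ι := σ ⊕ τ) (ι' := τ) (X := fun _ => ℝ)
    (fun _ => gam)
  rw [← hmp.integral_comp (MeasurableEquiv.measurableEmbedding _)]
  have e1 : ∀ p : (σ ⊕ τ → ℝ) × (τ → ℝ), ∀ s, lm (Lmat K a)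
      ((MeasurableEquiv.sumPiEquivProdPi (fun _ : (σ ⊕ τ) ⊕ τ => ℝ)).symm p) (.inl s) = p.1 (.inl s) := by
    intro p s
    simp [lm, Lmat, Fintype.sum_sum_type, MeasurableEquiv.sumPiEquivProdPi,
      Equiv.sumPiEquivProdPi]
  have e2 : ∀ p : (σ ⊕ τ → ℝ) × (τ → ℝ), ∀ t, lm (Lmat K a)
      ((MeasurableEquiv.sumPiEquivProdPi (fun _ : (σ ⊕ τ) ⊕ τ => ℝ)).symm p) (.inr t) =
        lm K p.1 t + a * p.2 t := by
    intro p t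
    simp [lm, Lmat, Fintype.sum_sum_type, MeasurableEquiv.sumPiEquivProdPi,
      Equiv.sumPiEquivProdPi]
  simp only [e1, e2]
  have mK : ∀ t, Measurable fun v : σ ⊕ τ → ℝ => lm K v t := fun t => by unfold lm; fun_prop
  rw [integral_prod]
  swap
  · apply integrable_of_abs_le_one
    · apply Measurable.mul
      · exact measurable_prod_sgn _ _ (fun t => by fun_prop)
      · exact measurable_prod_sgn _ (fun t (p : (σ ⊕ τ → ℝ) × (τ → ℝ)) => lm K p.1 t + a * p.2 t)
          (fun t => by have := mK t; fun_prop)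
    · intro x; rw [abs_mul, abs_prod_sgn, abs_prod_sgn]; norm_num
  have e3 : ∀ v : σ ⊕ τ → ℝ, ∫ z : τ → ℝ, (∏ s, sgn (v (.inl s))) *
      ∏ t, sgn (lm K v t + a * z t) ∂(gpi τ) = (∏ s, sgn (v (.inl s))) * ∏ t, hh a (lm K v t) := by
    intro v
    rw [integral_const_mul, integral_fintype_prod_eq_prod (f := fun t z => sgn (lm K v t + a * z))]
    rfl
  simp only [e3]
  refine abs_integral_le_integral_abs.trans ?_
  simp only [abs_mul, Finset.abs_prod, abs_sgn, Finset.prod_const_one, one_mul]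
  have hmes : Measurable fun y : τ → ℝ => ∏ t, |hh a (y t)| :=
    Finset.measurable_fun_prod _ fun t _ => ((measurable_hh a).comp (measurable_pi_apply t)).abs
  rw [← integral_map (φ := lm K) (measurable_lm K).aemeasurable
    (f := fun y => ∏ t, |hh a (y t)|) hmes.aestronglyMeasurable, map_lm_orth K r hK,
    integral_map (Measurable.aemeasurable (by fun_prop)) hmes.aestronglyMeasurable,
    integral_fintype_prod_eq_pow (f := fun z : ℝ => |hh a (r * z)|)]
  exact pow_le_pow_left₀ (integral_nonneg fun _ => abs_nonneg _) (integral_hh a r ha hr) _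

open scoped MatrixOrder in
lemma psd_factor {τ : Type} [Fintype τ] [DecidableEq τ] {A : Matrix τ τ ℝ} (hA : A.PosSemidef) :
    ∃ M : Matrix τ τ ℝ, A = M.conjTranspose * M :=
  CStarAlgebra.nonneg_iff_eq_star_mul_self.mp hA.nonneg

lemma main_bound {σ τ ι : Type} [Fintype σ] [Fintype τ] [Fintype ι] [DecidableEq σ] [DecidableEq τ]
    (R : σ → ι → ℝ) (Q : τ → ι → ℝ) (r : ℝ) (hr : 0 ≤ r) (hr2 : r ^ 2 ≤ 1 / 2)
    (hR : ∀ i j, ∑ l, R i l * R j l = if i = j then 1 else 0)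
    (hQ : ∀ i j, ∑ l, Q i l * Q j l = if i = j then 1 else 0)
    (hA : ∀ x : τ → ℝ, ∑ s, (∑ t, (∑ l, R s l * Q t l) * x t) ^ 2 ≤ r ^ 2 * ∑ t, x t ^ 2) :
    |∫ x, (∏ s, sgn (lm R x s)) * ∏ t, sgn (lm Q x t) ∂(gpi ι)| ≤ (2 * r) ^ Fintype.card τ := by
  set A : Matrix σ τ ℝ := Matrix.of fun s t => ∑ l, R s l * Q t l with hAdef
  have hps : (r ^ 2 • (1 : Matrix τ τ ℝ) - A.transpose * A).PosSemidef := by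
    refine Matrix.PosSemidef.of_dotProduct_mulVec_nonneg ?_ ?_
    · ext i j
      simp [Matrix.mul_apply, Matrix.one_apply, eq_comm, mul_comm]
    · intro x
      have h1 := hA x
      rw [Matrix.sub_mulVec, dotProduct_sub, ← Matrix.mulVec_mulVec, Matrix.dotProduct_mulVec (star x) A.transpose,
        Matrix.vecMul_transpose, Matrix.smul_mulVec, Matrix.one_mulVec]
      simp only [dotProduct, Matrix.mulVec, star_trivial, Pi.smul_apply, smul_eq_mul, hAdef, Matrix.of_apply]
      simp only [sq (∑ t, _)] at h1
      rw [sub_nonneg]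
      refine h1.trans_eq ?_
      rw [Finset.mul_sum]
      exact Finset.sum_congr rfl fun t _ => by ring
  obtain ⟨M, hM⟩ := psd_factor hps
  set a := √(1 - r ^ 2) with hadef
  have ha2 : a ^ 2 = 1 - r ^ 2 := Real.sq_sqrt (by linarith)
  have ha : 1 / 2 ≤ a := Real.le_sqrt_of_sq_le (by norm_num; linarith)
  set K : τ → σ ⊕ τ → ℝ := fun t => Sum.elim (fun s => A s t) (fun t' => M t' t) with hKdef
  have hK : ∀ i j, ∑ l, K i l * K j l = if i = j then r ^ 2 else 0 := by
    intro i j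
    have := congrFun (congrFun hM i) j
    simp only [Matrix.sub_apply, Matrix.smul_apply, Matrix.one_apply, Matrix.mul_apply,
      Matrix.transpose_apply, Matrix.conjTranspose_apply, star_trivial, smul_eq_mul, mul_ite, mul_one, mul_zero] at this
    rw [Fintype.sum_sum_type]
    simp only [hKdef, Sum.elim_inl, Sum.elim_inr]
    linarith
  have hF : Measurable fun y : σ ⊕ τ → ℝ => (∏ s, sgn (y (.inl s))) * ∏ t, sgn (y (.inr t)) :=
    (measurable_prod_sgn _ _ (fun t => by fun_prop)).mul (measurable_prod_sgn _ _ (fun t => by fun_prop))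
  have heq : (gpi ι).map (lm (Sum.elim R Q)) = (gpi ((σ ⊕ τ) ⊕ τ)).map (lm (Lmat K a)) := by
    apply map_lm_eq
    rintro (s | t) (s' | t')
    · simp [hR, Fintype.sum_sum_type, Lmat]
    · simp [Fintype.sum_sum_type, Lmat, hKdef, hAdef]
    · simp [Fintype.sum_sum_type, Lmat, hKdef, hAdef, mul_comm]
    · have := hK t t'
      rw [Fintype.sum_sum_type]
      simp only [Sum.elim_inr, hQ, Lmat, this]
      by_cases h : t = t'
      · simp [h, ← sq, ha2]
      · simp [h]
  have h1 := smooth_bound K r a hr (by linarith) hK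
  rw [← integral_map (φ := lm (Lmat K a)) (measurable_lm _).aemeasurable
    (f := fun y => (∏ s, sgn (y (.inl s))) * ∏ t, sgn (y (.inr t))) hF.aestronglyMeasurable,
    ← heq, integral_map (measurable_lm _).aemeasurable hF.aestronglyMeasurable] at h1
  refine h1.trans ?_
  gcongr
  rw [div_le_iff₀ (by linarith)]
  nlinarith

/-- split moment -/
noncomputable def Vmom {N : ℕ} (U : Fin N → Fin N → ℝ) (S T : Finset (Fin N)) : ℝ :=
  ∫ X, (∏ i ∈ S, sgn (X i)) * ∏ j ∈ T, sgn (∑ l, U l j * X l) ∂(stdGaussianVec N)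

lemma transpose_bound {σ τ : Type} [Fintype σ] [Fintype τ] (A : σ → τ → ℝ) (r : ℝ)
    (hA : ∀ x : τ → ℝ, ∑ s, (∑ t, A s t * x t) ^ 2 ≤ r ^ 2 * ∑ t, x t ^ 2) (y : σ → ℝ) :
    ∑ t, (∑ s, A s t * y s) ^ 2 ≤ r ^ 2 * ∑ s, y s ^ 2 := by
  set x : τ → ℝ := fun t => ∑ s, A s t * y s with hx
  have h1 : ∑ t, x t ^ 2 = ∑ s, y s * ∑ t, A s t * x t := by
    have : ∀ t, x t ^ 2 = ∑ s, A s t * y s * x t := by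
      intro t; rw [sq, ← Finset.sum_mul]
    simp_rw [this, Finset.mul_sum]
    rw [Finset.sum_comm]
    exact Finset.sum_congr rfl fun s _ => Finset.sum_congr rfl fun t _ => by ring
  have h2 := Finset.sum_mul_sq_le_sq_mul_sq Finset.univ y (fun s => ∑ t, A s t * x t)
  rw [← h1] at h2
  have h3 := hA x
  have hy : 0 ≤ ∑ s, y s ^ 2 := Finset.sum_nonneg fun _ _ => sq_nonneg _
  have hx0 : 0 ≤ ∑ t, x t ^ 2 := Finset.sum_nonneg fun _ _ => sq_nonneg _
  have h4 : (∑ t, x t ^ 2) * ∑ t, x t ^ 2 ≤ (r ^ 2 * ∑ s, y s ^ 2) * ∑ t, x t ^ 2 := by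
    calc _ = (∑ t, x t ^ 2) ^ 2 := by ring
      _ ≤ _ := h2
      _ ≤ (∑ s, y s ^ 2) * (r ^ 2 * ∑ t, x t ^ 2) := by gcongr
      _ = _ := by ring
  rcases hx0.eq_or_lt with h | h
  · rw [← h]; positivity
  · exact le_of_mul_le_mul_right h4 h

lemma Vmom_bound {N : ℕ} (U : Fin N → Fin N → ℝ) (hU : IsOrthogonal U) (S T : Finset (Fin N)) (r : ℝ)
    (hr : 0 ≤ r) (hr2 : r ^ 2 ≤ 1 / 2)
    (hA : ∀ x : T → ℝ, ∑ s : S, (∑ t : T, U s t * x t) ^ 2 ≤ r ^ 2 * ∑ t, x t ^ 2) :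
    |Vmom U S T| ≤ (2 * r) ^ T.card ∧ |Vmom U S T| ≤ (2 * r) ^ S.card := by
  set R : S → Fin N → ℝ := fun s l => if (s : Fin N) = l then 1 else 0 with hR
  set Q : T → Fin N → ℝ := fun t l => U l t with hQ
  have hR1 : ∀ i j, ∑ l, R i l * R j l = if i = j then 1 else 0 := by
    intro i j
    by_cases h : i = j
    · simp [hR, h]
    · simp [hR, h]
  have hQ1 : ∀ i j, ∑ l, Q i l * Q j l = if i = j then 1 else 0 := by
    intro i j
    simp only [hQ, hU.1, Subtype.coe_inj]
  have hRQ : ∀ s t, ∑ l, R s l * Q t l = U s t := by intro s t; simp [hR, hQ]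
  have hQR : ∀ t s, ∑ l, Q t l * R s l = U s t := by intro s t; simp [hR, hQ]
  have e1 : ∀ (x : Fin N → ℝ) s, lm R x s = x s := by intro x s; simp [lm, hR]
  have hV : Vmom U S T = ∫ x, (∏ s, sgn (lm R x s)) * ∏ t, sgn (lm Q x t) ∂(gpi (Fin N)) := by
    simp only [e1]
    unfold Vmom
    congr 1
    ext x
    rw [← Finset.prod_coe_sort S, ← Finset.prod_coe_sort T]
    rfl
  have h1 := main_bound R Q r hr hr2 hR1 hQ1 (by simpa only [hRQ] using hA)
  have h2 := main_bound Q R r hr hr2 hQ1 hR1 (by simpa only [hQR] using transpose_bound _ r hA)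
  simp_rw [mul_comm (∏ t, sgn (lm Q _ t))] at h2
  rw [← hV, Fintype.card_coe] at h1 h2
  exact ⟨h1, h2⟩

lemma Vmom_abs_le_one {N : ℕ} (U : Fin N → Fin N → ℝ) (S T : Finset (Fin N)) : |Vmom U S T| ≤ 1 := by
  have : IsProbabilityMeasure (stdGaussianVec N) := by unfold stdGaussianVec; infer_instance
  unfold Vmom
  refine abs_integral_le_integral_abs.trans ?_
  simp [abs_mul, Finset.abs_prod, abs_sgn]

lemma Vmom_eq_zero {N : ℕ} (U : Fin N → Fin N → ℝ) (hU : IsOrthogonal U) (S T : Finset (Fin N))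
    (h : ¬ (S.card = 0 ↔ T.card = 0)) : Vmom U S T = 0 := by
  have hA : ∀ x : T → ℝ, ∑ s : S, (∑ t : T, U s t * x t) ^ 2 ≤ (0:ℝ) ^ 2 * ∑ t, x t ^ 2 := by
    intro x
    by_cases hS : S.card = 0
    · have := Finset.card_eq_zero.1 hS; subst this; simp
    · have hT : T.card = 0 := by tauto
      have := Finset.card_eq_zero.1 hT; subst this; simp
  obtain ⟨h1, h2⟩ := Vmom_bound U hU S T 0 le_rfl (by norm_num) hA
  rw [mul_zero] at h1 h2
  by_cases hS : S.card = 0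
  · have hT : T.card ≠ 0 := by tauto
    rw [zero_pow hT] at h1
    exact abs_eq_zero.1 (le_antisymm h1 (abs_nonneg _))
  · rw [zero_pow hS] at h2
    exact abs_eq_zero.1 (le_antisymm h2 (abs_nonneg _))

lemma opNorm_spec {m n : Type} [Fintype m] [Fintype n] (A : m → n → ℝ) (r : ℝ)
    (h : opNorm A ≤ r) (x : n → ℝ) :
    ∑ i, (∑ j, A i j * x j) ^ 2 ≤ r ^ 2 * ∑ j, x j ^ 2 := by
  by_cases hx : x = 0
  · subst hx; simp
  have hpos : ∀ x : n → ℝ, x ≠ 0 → 0 < ∑ j, x j ^ 2 := by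
    intro x hx
    obtain ⟨j, hj⟩ := Function.ne_iff.1 hx
    exact Finset.sum_pos' (fun _ _ => sq_nonneg _) ⟨j, Finset.mem_univ _, by simpa using sq_pos_of_ne_zero hj⟩
  have hb : BddAbove {r : ℝ | ∃ x : n → ℝ, x ≠ 0 ∧
      r = Real.sqrt (∑ i, (∑ j, A i j * x j) ^ 2) / Real.sqrt (∑ j, x j ^ 2)} := by
    refine ⟨√(∑ i, ∑ j, A i j ^ 2), ?_⟩
    rintro _ ⟨x, hx, rfl⟩
    rw [div_le_iff₀ (Real.sqrt_pos.2 (hpos x hx)), ← Real.sqrt_mul (by positivity)]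
    apply Real.sqrt_le_sqrt
    rw [Finset.sum_mul]
    exact Finset.sum_le_sum fun i _ => Finset.sum_mul_sq_le_sq_mul_sq _ _ _
  have h1 := (le_csSup hb ⟨x, hx, rfl⟩).trans h
  rw [div_le_iff₀ (Real.sqrt_pos.2 (hpos x hx))] at h1
  have h2 := pow_le_pow_left₀ (Real.sqrt_nonneg _) h1 2
  rwa [mul_pow, Real.sq_sqrt (by positivity), Real.sq_sqrt (by positivity)] at h2

lemma Vmom_q {N : ℕ} (hN : 2 ≤ N) (U : Fin N → Fin N → ℝ) (hU : IsOrthogonal U) (hG : IsGood U)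
    (S T : Finset (Fin N)) (m : ℕ) (hm : S.card + T.card ≤ m) (hm0 : 0 < m)
    (q : ℝ) (hq : q = 400 * m * Real.log N / N) (hq1 : q ≤ 1) :
    |Vmom U S T| ≤ q ^ (((max S.card T.card : ℕ) : ℝ) / 2) := by
  have hN0 : (0 : ℝ) < N := by positivity
  have hlog : 0 < Real.log N := Real.log_pos (by exact_mod_cast hN)
  have hm0' : (0 : ℝ) < m := by exact_mod_cast hm0
  have hq0 : 0 < q := by rw [hq]; positivity
  by_cases hz : (S.card = 0 ↔ T.card = 0)
  swap
  · rw [Vmom_eq_zero U hU S T hz, abs_zero]; positivity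
  by_cases hS : S.card = 0
  · have hT := hz.1 hS
    simp only [hS, hT, max_self, Nat.cast_zero, zero_div, Real.rpow_zero]
    exact Vmom_abs_le_one U S T
  have hT : T.card ≠ 0 := by tauto
  set r := Real.sqrt (100 * (S.card + T.card) * Real.log N / N) with hr
  have hr0 : 0 ≤ r := Real.sqrt_nonneg _
  have hr2 : r ^ 2 = 100 * (S.card + T.card) * Real.log N / N := Real.sq_sqrt (by positivity)
  have h4 : 4 * r ^ 2 ≤ q := by
    have : (S.card + T.card : ℝ) ≤ m := by exact_mod_cast hm
    rw [hr2, hq]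
    calc 4 * (100 * (S.card + T.card : ℝ) * Real.log N / N) 
        = 400 * (S.card + T.card : ℝ) * Real.log N / N := by ring
      _ ≤ _ := by gcongr
  have hg := hG S T (Finset.card_ne_zero.1 hS) (Finset.card_ne_zero.1 hT)
  obtain ⟨h1, h2⟩ := Vmom_bound U hU S T r hr0 (by linarith) (fun x => opNorm_spec _ r hg x)
  have h5 : 2 * r ≤ q ^ (1 / 2 : ℝ) := by
    rw [← Real.sqrt_eq_rpow]
    apply Real.le_sqrt_of_sq_le
    linarith [mul_pow 2 r 2]
  have h6 : |Vmom U S T| ≤ (2 * r) ^ (max S.card T.card) := by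
    rcases max_choice S.card T.card with h | h <;> rw [h] <;> assumption
  refine h6.trans ((pow_le_pow_left₀ (by positivity) h5 _).trans_eq ?_)
  rw [← Real.rpow_natCast, ← Real.rpow_mul hq0.le]
  congr 1; ring

lemma sgn_mul {a b : ℝ} (ha : a ≠ 0) (hb : b ≠ 0) : sgn (a * b) = sgn a * sgn b := by
  unfold sgn
  rcases lt_or_gt_of_ne ha with h1 | h1 <;> rcases lt_or_gt_of_ne hb with h2 | h2
  · simp [(mul_pos_of_neg_of_neg h1 h2).le, not_le.2 h1, not_le.2 h2]
  · simp [mul_neg_of_neg_of_pos h1 h2, not_le.2 h1, h2.le]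
  · simp [mul_neg_of_pos_of_neg h1 h2, not_le.2 h2, h1.le]
  · simp [(mul_pos h1 h2).le, h1.le, h2.le]

lemma ae_X {N : ℕ} : ∀ᵐ x ∂(stdGaussianVec N), ∀ j, x j ≠ 0 := by
  rw [ae_all_iff]
  intro j
  have h : MeasurePreserving (Function.eval j) (stdGaussianVec N) gam :=
    measurePreserving_eval (fun _ : Fin N => gam) j
  have h0 : ∀ᵐ t ∂gam, t ≠ 0 := by
    have := ProbabilityTheory.nullSingletonClass_gaussianReal (μ := 0) (v := 1) (by simp)
    have h1 : gam {0} = 0 := measure_singleton 0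
    simpa [ae_iff] using h1
  exact h.quasiMeasurePreserving.ae h0

lemma ae_Y {N : ℕ} (U : Fin N → Fin N → ℝ) (hU : IsOrthogonal U) :
    ∀ᵐ x ∂(stdGaussianVec N), ∀ j, ∑ l, U l j * x l ≠ 0 := by
  have h : MeasurePreserving (lm (fun j l => U l j)) (stdGaussianVec N) (stdGaussianVec N) := by
    refine ⟨measurable_lm _, ?_⟩
    have := map_lm_orth (fun j l => U l j) 1 (by intro i j; rw [hU.1]; simp)
    simp only [one_mul, Measure.map_id'] at this
    exact this
  exact h.quasiMeasurePreserving.ae ae_X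

lemma ae_all {N n : ℕ} (U : Fin N → Fin N → ℝ) (hU : IsOrthogonal U) :
    ∀ᵐ X ∂(stdGaussianFam N n), ∀ i j, X i j ≠ 0 ∧ ∑ l, U l j * X i l ≠ 0 := by
  have : IsProbabilityMeasure (stdGaussianVec N) := by unfold stdGaussianVec; infer_instance
  rw [ae_all_iff]
  intro i
  have h : MeasurePreserving (Function.eval i) (stdGaussianFam N n) (stdGaussianVec N) :=
    measurePreserving_eval (fun _ : Fin n => stdGaussianVec N) i
  refine h.quasiMeasurePreserving.ae (p := fun x => ∀ j, x j ≠ 0 ∧ ∑ l, U l j * x l ≠ 0) ?_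
  filter_upwards [ae_X, ae_Y U hU] with x h1 h2 j
  exact ⟨h1 j, h2 j⟩

/-- block -/
def Blk {N k : ℕ} (S : Finset (Fin k × Fin N)) (a : Fin k) : Finset (Fin N) :=
  Finset.univ.filter fun j => (a, j) ∈ S

lemma Blk_card {N k : ℕ} (S : Finset (Fin k × Fin N)) : ∑ a, (Blk S a).card = S.card := by
  have := Finset.sum_finset_product S Finset.univ (Blk S) (by simp [Blk]) (f := fun _ => 1)
  simpa using this.symm

lemma sgn_Z {N n : ℕ} (U : Fin N → Fin N → ℝ) (X : Fin (n + 1) → Fin N → ℝ)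
    (h : ∀ i j, X i j ≠ 0 ∧ ∑ l, U l j * X i l ≠ 0) (a : Fin (n + 2)) (j : Fin N) :
    sgn (Zfam N (n + 2) U X a j) =
      (Fin.lastCases (motive := fun _ => ℝ) 1 (fun i => sgn (X i j)) a) *
      (Fin.cases (motive := fun _ => ℝ) 1 (fun i => sgn (∑ l, U l j * X i l)) a) := by
  induction a using Fin.cases with
  | zero =>
    have : (0 : Fin (n + 2)) = Fin.castSucc 0 := rfl
    simp only [Fin.cases_zero, mul_one]
    rw [this, Fin.lastCases_castSucc]
    simp [Zfam]
  | succ i =>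
    rw [Fin.cases_succ]
    induction i using Fin.lastCases with
    | last =>
      rw [Fin.succ_last, Fin.lastCases_last]
      simp [Zfam]
      rfl
    | cast i =>
      have hi := i.2
      rw [Fin.succ_castSucc, Fin.lastCases_castSucc, mul_comm, ← sgn_mul (h _ _).2 (h _ _).1]
      congr 1
      have h1 : ¬ ((i.succ.castSucc : Fin (n + 2)).val = 0) := by simp
      have h2 : ¬ ((i.succ.castSucc : Fin (n + 2)).val = n + 2 - 1) := by simp; omega
      unfold Zfam
      rw [if_neg h1, if_neg h2, dif_pos ⟨by simp, by simp⟩]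
      rfl

lemma Dhat_factor {N n : ℕ} (U : Fin N → Fin N → ℝ) (hU : IsOrthogonal U)
    (S : Finset (Fin (n + 2) × Fin N)) :
    Dhat N (n + 2) U S = ∏ i : Fin (n + 1), Vmom U (Blk S i.castSucc) (Blk S i.succ) := by
  have : IsProbabilityMeasure (stdGaussianVec N) := by unfold stdGaussianVec; infer_instance
  unfold Vmom
  rw [← integral_fintype_prod_eq_prod (f := fun (i : Fin (n + 1)) (x : Fin N → ℝ) =>
    (∏ j ∈ Blk S i.castSucc, sgn (x j)) * ∏ j ∈ Blk S i.succ, sgn (∑ l, U l j * x l))]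
  unfold Dhat
  apply integral_congr_ae
  filter_upwards [ae_all (n := n + 1) U hU] with X hX
  rw [Finset.prod_finset_product S Finset.univ (Blk S) (by simp [Blk])]
  simp only [sgn_Z U X hX, Finset.prod_mul_distrib]
  congr 1
  · rw [Fin.prod_univ_castSucc]
    simp
  · rw [Fin.prod_univ_succ]
    simp

lemma sum_max (n : ℕ) (s : Fin (n + 2) → ℕ) :
    ((∑ a, s a : ℕ) : ℝ) * (1 - 1 / ((n + 2 : ℕ) : ℝ)) ≤
      ((∑ i : Fin (n + 1), max (s i.castSucc) (s i.succ) : ℕ) : ℝ) := by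
  obtain ⟨m, -, hm⟩ := Finset.exists_min_image Finset.univ s ⟨0, Finset.mem_univ _⟩
  have h1 : (n + 2) * s m ≤ ∑ a, s a := by
    have := Finset.card_nsmul_le_sum Finset.univ s (s m) (fun x hx => hm x hx)
    simpa using this
  have h2 : ∑ i, s (m.succAbove i) ≤ ∑ i : Fin (n + 1), max (s i.castSucc) (s i.succ) := by
    refine Finset.sum_le_sum fun i _ => ?_
    unfold Fin.succAbove
    split_ifs <;> simp
  have h3 := Fin.sum_univ_succAbove s m
  have h1' : ((n + 2 : ℕ) : ℝ) * s m ≤ ((∑ a, s a : ℕ) : ℝ) := by exact_mod_cast h1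
  have h2' : ((∑ a, s a : ℕ) : ℝ) ≤ s m +
      ((∑ i : Fin (n + 1), max (s i.castSucc) (s i.succ) : ℕ) : ℝ) := by
    have h4 : ∑ a, s a ≤ s m + ∑ i : Fin (n + 1), max (s i.castSucc) (s i.succ) := by
      rw [h3]; exact Nat.add_le_add_left h2 _
    exact_mod_cast h4
  have hk : (0 : ℝ) < ((n + 2 : ℕ) : ℝ) := by positivity
  have h5 : (s m : ℝ) ≤ ((∑ a, s a : ℕ) : ℝ) / ((n + 2 : ℕ) : ℝ) := by
    rw [le_div_iff₀ hk]; linarith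
  have h6 : ((∑ a, s a : ℕ) : ℝ) * (1 - 1 / ((n + 2 : ℕ) : ℝ)) =
    ((∑ a, s a : ℕ) : ℝ) - ((∑ a, s a : ℕ) : ℝ) / ((n + 2 : ℕ) : ℝ) := by ring
  rw [h6]; linarith

lemma Dhat_abs_le_one {N k : ℕ} (U : Fin N → Fin N → ℝ) (S : Finset (Fin k × Fin N)) :
    |Dhat N k U S| ≤ 1 := by
  have : IsProbabilityMeasure (stdGaussianVec N) := by unfold stdGaussianVec; infer_instance
  have : IsProbabilityMeasure (stdGaussianFam N (k - 1)) := by unfold stdGaussianFam; infer_instance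
  unfold Dhat
  refine abs_integral_le_integral_abs.trans ?_
  simp [Finset.abs_prod, abs_sgn]

/-- moment bounds for good matrices: there is a universal
constant `c > 0` such that for all `N ≥ 2`, `k ≥ 2` and every good orthogonal
`U ∈ ℝ^{N×N}`, for every nonempty `S ⊆ [kN]`:
`|D̂_{U,k}(S)| ≤ (c·|S|·ln N / N)^{|S|·(1-1/k)/2}`, and moreover
`D̂_{U,k}(S) = 0` whenever `|S| < k`. -/
theorem moment_bounds_good_matrices :
    ∃ c : ℝ, 0 < c ∧
      ∀ (N k : ℕ), 2 ≤ N → 2 ≤ k →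
        ∀ U : Fin N → Fin N → ℝ, IsOrthogonal U → IsGood U →
          ∀ S : Finset (Fin k × Fin N), S.Nonempty →
            |Dhat N k U S| ≤
              (c * S.card * Real.log N / N) ^ ((S.card : ℝ) * (1 - 1 / (k : ℝ)) / 2) ∧
            (S.card < k → Dhat N k U S = 0) := by
  refine ⟨400, by norm_num, ?_⟩
  intro N k hN hk U hU hG S hS
  obtain ⟨n, rfl⟩ : ∃ n, k = n + 2 := ⟨k - 2, by omega⟩
  have hm0 : 0 < S.card := hS.card_pos
  constructor
  · have hN0 : (0 : ℝ) < N := by positivity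
    have hlog : 0 < Real.log N := Real.log_pos (by exact_mod_cast hN)
    have hm0' : (0 : ℝ) < S.card := by exact_mod_cast hm0
    set q : ℝ := 400 * S.card * Real.log N / N with hq
    have hq0 : 0 < q := by rw [hq]; positivity
    have hk1 : 0 ≤ 1 - 1 / ((n + 2 : ℕ) : ℝ) := by
      rw [sub_nonneg, div_le_one (by positivity)]
      push_cast; linarith [(Nat.cast_nonneg n : (0:ℝ) ≤ n)]
    rcases le_total 1 q with h1 | h1
    · exact (Dhat_abs_le_one U S).trans (Real.one_le_rpow h1 (by positivity))
    rw [Dhat_factor U hU, Finset.abs_prod]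
    have hle : ∀ i : Fin (n + 1), (Blk S i.castSucc).card + (Blk S i.succ).card ≤ S.card := by
      intro i
      rw [← Blk_card S]
      have hne : i.castSucc ≠ i.succ := (Fin.castSucc_lt_succ).ne
      rw [← Finset.sum_pair (f := fun a => (Blk S a).card) hne]
      exact Finset.sum_le_sum_of_subset (Finset.subset_univ _)
    calc ∏ i : Fin (n + 1), |Vmom U (Blk S i.castSucc) (Blk S i.succ)|
        ≤ ∏ i : Fin (n + 1), q ^ (((max (Blk S i.castSucc).card (Blk S i.succ).card : ℕ) : ℝ) / 2) :=
          Finset.prod_le_prod (fun _ _ => abs_nonneg _)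
            fun i _ => Vmom_q hN U hU hG _ _ S.card (hle i) hm0 q hq h1
      _ = q ^ (∑ i : Fin (n + 1), (((max (Blk S i.castSucc).card (Blk S i.succ).card : ℕ) : ℝ) / 2)) :=
          (Real.rpow_sum_of_pos hq0 _ _).symm
      _ ≤ _ := by
          apply Real.rpow_le_rpow_of_exponent_ge hq0 h1
          rw [← Finset.sum_div]
          have := sum_max n (fun a => (Blk S a).card)
          rw [Blk_card] at this
          rw [← Nat.cast_sum]
          linarith
  · intro hlt
    rw [Dhat_factor U hU]
    by_contra hne
    rw [← ne_eq, Finset.prod_ne_zero_iff] at hne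
    have h1 : ∀ i : Fin (n + 1), ((Blk S i.castSucc).card = 0 ↔ (Blk S i.succ).card = 0) := by
      intro i
      by_contra h
      exact hne i (Finset.mem_univ _) (Vmom_eq_zero U hU _ _ h)
    have h2 : ∀ a : Fin (n + 2), ((Blk S 0).card = 0 ↔ (Blk S a).card = 0) := by
      intro a
      induction a using Fin.induction with
      | zero => rfl
      | succ i ih => exact ih.trans (h1 i)
    have hsum := Blk_card S
    by_cases h0 : (Blk S 0).card = 0
    · rw [Finset.sum_eq_zero fun a _ => (h2 a).1 h0] at hsum
      omega
    · have : ∑ a : Fin (n + 2), 1 ≤ ∑ a, (Blk S a).card :=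
        Finset.sum_le_sum fun a _ => Nat.one_le_iff_ne_zero.2 fun h => h0 ((h2 a).2 h)
      simp at this
      omega
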